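/- Let d ≥ 2 be an even integer, let k ≥ 2 be an even integer, and set p = k + (d−2)/2. Then ∫_{−1}^{1} (1/(4π)) (t + 1)(π − arccos t) · (d^k/dt^k)[(1 − t²)^p] dt = (1/2) Σ_{q = ⌈k/2⌉}^{p} C2(q,d,k) · ( −1/(2(2q − k + 1)) + (1/(2(2q − k + 2))) · (1 − (1/2^{2q−k+2}) · binom(2q − k + 2, (2q − k + 2)/2)) ), where C2(q,d,k) = (−1)^q binom(p, q) (2q)!/(2q − k)!. -/

import Mathlib

open Real

/-- The integral of `sin ^ (2 * n)` over `[-π/2, π/2]`, through the central binomial coefficient. -/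
theorem integral_sin_pow_even_symm (n : ℕ) :
    ∫ x in (-(π / 2))..(π / 2), sin x ^ (2 * n) = π * (Nat.centralBinom n : ℝ) / 2 ^ (2 * n) := by
  induction n with
  | zero => simp
  | succ n ih =>
    have h : ((n + 1 : ℕ) : ℝ) * (Nat.centralBinom (n + 1) : ℝ)
        = 2 * (2 * n + 1) * (Nat.centralBinom n : ℝ) := by
      exact_mod_cast Nat.succ_mul_centralBinom_succ n
    have h' : (Nat.centralBinom (n + 1) : ℝ)
        = 2 * (2 * n + 1) * (Nat.centralBinom n : ℝ) / (n + 1) := by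
      rw [eq_div_iff (by positivity), ← h]; push_cast; ring
    rw [show 2 * (n + 1) = 2 * n + 2 by ring, integral_sin_pow, ih, h']
    simp only [cos_neg, cos_pi_div_two]
    push_cast
    field_simp
    ring

theorem integral_pow_mul_arcsin (n : ℕ) :
    ∫ t in (-1 : ℝ)..1, t ^ (2 * n + 1) * arcsin t
      = π / (2 * n + 2) * (1 - (Nat.centralBinom (n + 1) : ℝ) / 2 ^ (2 * n + 2)) := by
  have hsub : ∫ t in (-1 : ℝ)..1, t ^ (2 * n + 1) * arcsin t
      = ∫ x in (-(π / 2))..(π / 2), x * (sin x ^ (2 * n + 1) * cos x) := by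
    have h := intervalIntegral.integral_comp_mul_deriv (a := -(π / 2)) (b := π / 2)
      (f := sin) (f' := cos) (g := fun t => t ^ (2 * n + 1) * arcsin t)
      (fun x _ => hasDerivAt_sin x) continuous_cos.continuousOn (by fun_prop)
    rw [sin_neg, sin_pi_div_two] at h
    rw [← h]
    refine intervalIntegral.integral_congr fun x hx => ?_
    rw [Set.uIcc_of_le (by linarith [pi_pos])] at hx
    simp only [Function.comp, arcsin_sin hx.1 hx.2]
    ring
  have hparts := intervalIntegral.integral_mul_deriv_eq_deriv_mul (a := -(π / 2)) (b := π / 2)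
    (u := fun x => x) (u' := fun _ => 1) (v := fun x => sin x ^ (2 * n + 2) / (2 * n + 2))
    (v' := fun x => sin x ^ (2 * n + 1) * cos x)
    (fun x _ => hasDerivAt_id' x)
    (fun x _ => by
      have h := ((hasDerivAt_sin x).pow (2 * n + 2)).div_const (2 * n + 2 : ℝ)
      refine h.congr_deriv ?_
      rw [show 2 * n + 2 - 1 = 2 * n + 1 by omega]
      push_cast
      field_simp)
    intervalIntegrable_const
    (Continuous.intervalIntegrable (by fun_prop) _ _)
  rw [hsub, hparts]
  simp only [one_mul, intervalIntegral.integral_div]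
  rw [show 2 * n + 2 = 2 * (n + 1) by ring, integral_sin_pow_even_symm, sin_neg, sin_pi_div_two,
    one_pow, Even.neg_one_pow (even_two_mul _)]
  field_simp
  ring

/-- The even moments of `(t + 1) (π - arccos t)` on `[-1, 1]`. -/
theorem integral_kernel_mul_pow (n : ℕ) :
    ∫ t in (-1 : ℝ)..1, (1 / (4 * π)) * (t + 1) * (π - arccos t) * t ^ (2 * n)
      = 1 / (4 * (2 * n + 1))
        + 1 / (4 * (2 * n + 2)) * (1 - (Nat.centralBinom (n + 1) : ℝ) / 2 ^ (2 * n + 2)) := by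
  have hodd : ∀ f : ℝ → ℝ, (∀ x, f (-x) = -f x) → ∫ t in (-1 : ℝ)..1, f t = 0 := by
    intro f hf
    have h := intervalIntegral.integral_comp_neg (a := -1) (b := 1) f
    simp only [hf, intervalIntegral.integral_neg, neg_neg] at h
    linarith
  have h1 : ∫ t in (-1 : ℝ)..1, t ^ (2 * n + 1) = 0 :=
    hodd _ fun x => Odd.neg_pow ⟨n, rfl⟩ x
  have h2 : ∫ t in (-1 : ℝ)..1, t ^ (2 * n) * arcsin t = 0 :=
    hodd _ fun x => by rw [arcsin_neg, Even.neg_pow ⟨n, by ring⟩]; ring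
  have h3 : ∫ t in (-1 : ℝ)..1, t ^ (2 * n) = 2 / (2 * n + 1) := by
    rw [integral_pow, one_pow, Odd.neg_one_pow ⟨n, rfl⟩]
    push_cast
    ring
  have hsplit : ∀ t : ℝ, (1 / (4 * π)) * (t + 1) * (π - arccos t) * t ^ (2 * n)
      = 1 / 8 * t ^ (2 * n) + 1 / 8 * t ^ (2 * n + 1)
        + 1 / (4 * π) * (t ^ (2 * n) * arcsin t)
        + 1 / (4 * π) * (t ^ (2 * n + 1) * arcsin t) := by
    intro t
    rw [arccos]
    field_simp
    ring
  simp only [hsplit]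
  rw [intervalIntegral.integral_add, intervalIntegral.integral_add, intervalIntegral.integral_add]
  · simp only [intervalIntegral.integral_const_mul]
    rw [h1, h2, h3, integral_pow_mul_arcsin]
    field_simp
    ring
  all_goals exact Continuous.intervalIntegrable (by fun_prop) _ _

open Polynomial in
theorem iteratedDeriv_eval (P : ℝ[X]) (k : ℕ) :
    iteratedDeriv k (fun s : ℝ => P.eval s) = fun t => (derivative^[k] P).eval t := by
  induction k generalizing P with
  | zero => simp
  | succ k ih =>
    rw [iteratedDeriv_succ', Function.iterate_succ_apply, ← ih]
    congr 1
    ext t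
    exact P.deriv

open Polynomial in
/-- The `k`-th derivative of `(1 - s²) ^ p` expanded in monomials. -/
theorem iteratedDeriv_one_sub_sq_pow (k p : ℕ) (t : ℝ) :
    iteratedDeriv k (fun s : ℝ => (1 - s ^ 2) ^ p) t
      = ∑ q ∈ Finset.Icc ((k + 1) / 2) p, ((-1 : ℝ) ^ q * (Nat.choose p q : ℝ)
          * (((2 * q).factorial : ℝ) / ((2 * q - k).factorial : ℝ))) * t ^ (2 * q - k) := by
  have hexp : (fun s : ℝ => (1 - s ^ 2) ^ p) = fun s : ℝ =>
      (∑ q ∈ Finset.range (p + 1), C ((-1 : ℝ) ^ q * (Nat.choose p q : ℝ)) * X ^ (2 * q)).eval s := by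
    ext s
    rw [sub_eq_neg_add, add_pow, eval_finsetSum]
    refine Finset.sum_congr rfl fun q _ => ?_
    simp only [eval_mul, eval_C, eval_pow, eval_X, one_pow, mul_one]
    rw [neg_pow, pow_mul]
    ring
  rw [hexp, iteratedDeriv_eval]
  simp only [iterate_derivative_sum, iterate_derivative_C_mul, eval_finsetSum]
  symm
  refine Finset.sum_subset_zero_on_sdiff (fun q hq => ?_) (fun q hq => ?_) (fun q hq => ?_)
  · simp only [Finset.mem_Icc, Finset.mem_range] at *
    omega
  · simp only [Finset.mem_sdiff, Finset.mem_Icc, Finset.mem_range] at hq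
    rw [iterate_derivative_X_pow_eq_natCast_mul, Nat.descFactorial_of_lt (by omega)]
    simp
  · simp only [Finset.mem_Icc] at hq
    rw [iterate_derivative_X_pow_eq_natCast_mul]
    have h := Nat.factorial_mul_descFactorial (n := 2 * q) (k := k) (by omega)
    have h' : ((2 * q).factorial : ℝ) / ((2 * q - k).factorial : ℝ)
        = ((2 * q).descFactorial k : ℝ) := by
      rw [div_eq_iff (by positivity), ← h]
      push_cast
      ring
    rw [h']
    simp
    ring

open Polynomial in
/-- The derivatives of order `1, …, p` of `(1 - s²) ^ p` have mean zero on `[-1, 1]`. -/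
theorem integral_iteratedDeriv_one_sub_sq_pow {k p : ℕ} (hk : 0 < k) (hkp : k ≤ p) :
    ∫ t in (-1 : ℝ)..1, iteratedDeriv k (fun s : ℝ => (1 - s ^ 2) ^ p) t = 0 := by
  obtain ⟨j, rfl⟩ : ∃ j, k = j + 1 := ⟨k - 1, by omega⟩
  set P : ℝ[X] := (1 - X ^ 2) ^ p with hP
  have hfun : (fun s : ℝ => (1 - s ^ 2) ^ p) = fun s => P.eval s := by
    ext s
    simp [hP]
  have hroot : ∀ a : ℝ, (X - C a) ∣ (1 - X ^ 2 : ℝ[X]) → (derivative^[j] P).eval a = 0 := by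
    intro a ha
    have h := pow_sub_dvd_iterate_derivative_of_pow_dvd j (pow_dvd_pow_of_dvd ha p)
    exact dvd_iff_isRoot.mp ((dvd_pow_self _ (by omega)).trans h)
  have hone : (derivative^[j] P).eval 1 = 0 := hroot 1 ⟨-(X + 1), by simp; ring⟩
  have hneg : (derivative^[j] P).eval (-1) = 0 := hroot (-1) ⟨1 - X, by simp; ring⟩
  rw [hfun, iteratedDeriv_eval, intervalIntegral.integral_eq_sub_of_hasDerivAt
    (f := fun t => (derivative^[j] P).eval t)]
  · rw [hone, hneg, sub_zero]
  · intro t _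
    rw [Function.iterate_succ_apply']
    exact (derivative^[j] P).hasDerivAt t
  · exact (Polynomial.continuous _).intervalIntegrable _ _

/-- For even `d ≥ 2` and even `k ≥ 2`, with `p = k + (d−2)/2`:
`∫_{−1}^{1} K̄∞(t) (d^k/dt^k)[(1−t²)^p] dt
  = (1/2) Σ_{q=⌈k/2⌉}^{p} C2(q,d,k) ( −1/(2(2q−k+1))
      + (1/(2(2q−k+2)))(1 − 2^{−(2q−k+2)} C(2q−k+2,(2q−k+2)/2)) )`,
where `K̄∞(t) = (1/(4π))(t+1)(π − arccos t)` and `C2(q,d,k) = (−1)^q C(p,q) (2q)!/(2q−k)!`. -/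
theorem eigenvalue_bias_adjusted_even (d k : ℕ) (hd : 2 ≤ d) (hde : Even d)
    (hk : 2 ≤ k) (hke : Even k) :
    (∫ t in (-1:ℝ)..1,
        (1 / (4 * π)) * (t + 1) * (π - Real.arccos t)
          * iteratedDeriv k (fun s : ℝ => (1 - s ^ 2) ^ (k + (d - 2) / 2)) t)
      = (1 / 2) * ∑ q ∈ Finset.Icc ((k + 1) / 2) (k + (d - 2) / 2),
          ((-1 : ℝ) ^ q * (Nat.choose (k + (d - 2) / 2) q : ℝ)
              * (((2 * q).factorial : ℝ) / ((2 * q - k).factorial : ℝ)))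
            * (-1 / (2 * ((2 * q - k + 1 : ℕ) : ℝ))
                + (1 / (2 * ((2 * q - k + 2 : ℕ) : ℝ)))
                  * (1 - (1 : ℝ) / 2 ^ (2 * q - k + 2)
                      * (Nat.choose (2 * q - k + 2) ((2 * q - k + 2) / 2) : ℝ))) := by
  obtain ⟨l, hl⟩ := hke
  set p := k + (d - 2) / 2 with hp
  have hzero := integral_iteratedDeriv_one_sub_sq_pow (k := k) (p := p) (by omega) (by omega)
  simp only [iteratedDeriv_one_sub_sq_pow] at hzero ⊢
  simp only [Finset.mul_sum]
  rw [intervalIntegral.integral_finsetSum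
    fun q _ => Continuous.intervalIntegrable (by fun_prop) _ _] at hzero
  rw [intervalIntegral.integral_finsetSum
    fun q _ => Continuous.intervalIntegrable (by fun_prop) _ _]
  rw [← sub_eq_zero, ← Finset.sum_sub_distrib, ← mul_zero (1 / 4 : ℝ), ← hzero, Finset.mul_sum]
  refine Finset.sum_congr rfl fun q hq => ?_
  rw [Finset.mem_Icc] at hq
  obtain ⟨n, hn⟩ : ∃ n, q = n + l := ⟨q - l, by omega⟩
  rw [show 2 * q - k = 2 * n by omega]
  generalize (-1 : ℝ) ^ q * (Nat.choose p q : ℝ)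
    * (((2 * q).factorial : ℝ) / ((2 * n).factorial : ℝ)) = c
  have hcentral : Nat.choose (2 * n + 2) ((2 * n + 2) / 2) = Nat.centralBinom (n + 1) := by
    rw [Nat.centralBinom_eq_two_mul_choose, show (2 * n + 2) / 2 = n + 1 by omega]
    rfl
  have hker := integral_kernel_mul_pow n
  have hmove : ∀ t : ℝ, (1 / (4 * π)) * (t + 1) * (π - arccos t) * (c * t ^ (2 * n))
      = c * ((1 / (4 * π)) * (t + 1) * (π - arccos t) * t ^ (2 * n)) := fun t => by ring
  simp only [hmove, intervalIntegral.integral_const_mul]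
  rw [hker, hcentral, integral_pow, one_pow, Odd.neg_one_pow ⟨n, rfl⟩]
  push_cast
  field_simp
  ring
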